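/- Let k = 3 and let β ∈ (2, 3) be such that n := max{m ∈ N : S(m) ≤ d_β(1)} lies in ℕ^ℕ and is exceptional (Φ^{-1}(n) is not a singleton). For s ≥ 1 let α^{(β,s)} ∈ Δ be the digit-frequency vector of the first s digits of d_β(1) (the i-th coordinate is the number of occurrences of digit i among the first s digits, divided by s), and let F_β ⊆ Δ be the set of limits of convergent subsequences of (α^{(β,s)})_{s≥1}. Then F_β = Φ^{-1}(n). -/

import Mathlib

open Filter Topology
open scoped Classical

namespace BetaDF

/-- Digit sequences (elements of `Σ = {0,…,k−1}^ℕ` when all entries are `< k`). -/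
abbrev Seq : Type := ℕ → ℕ

/-- Lexicographic (strict) order on digit sequences. -/
def seqLt (v w : Seq) : Prop := ∃ r, (∀ s, s < r → v s = w s) ∧ v r < w r

/-- Lexicographic order on digit sequences. -/
def seqLe (v w : Seq) : Prop := seqLt v w ∨ v = w

/-- The shift map `σ`. -/
def shift (w : Seq) : Seq := fun r => w (r + 1)

/-- Membership in `Σ = {0,…,k−1}^ℕ`. -/
def InSigma (k : ℕ) (w : Seq) : Prop := ∀ r, w r < k

/-- A sequence is maximal if it is `≥` every element of its shift orbit. -/
def IsMaximal (w : Seq) : Prop := ∀ r, seqLe (shift^[r] w) w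

/-- Number of occurrences of the digit `i` among the first `r` entries of `w`. -/
def digitCount (w : Seq) (i r : ℕ) : ℕ := ((Finset.range r).filter fun s => w s = i).card

/-- The ambient Euclidean space `ℝ^k`. -/
abbrev E (k : ℕ) : Type := EuclideanSpace ℝ (Fin k)

/-- The `i`-th coordinate (with junk value `0` for `i ≥ k`). -/
def proj {k : ℕ} (α : E k) (i : ℕ) : ℝ := if h : i < k then α ⟨i, h⟩ else 0

/-- `w` has digit frequency vector `α`. -/
def HasDigitFreq (k : ℕ) (w : Seq) (α : E k) : Prop :=
  ∀ i, i < k →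
    Tendsto (fun r => (digitCount w i r : ℝ) / (r : ℝ)) atTop (𝓝 (proj α i))

/-- The standard `(k−1)`-simplex `Δ`. -/
def simplex (k : ℕ) : Set (E k) := {α | (∀ i : Fin k, 0 ≤ α i) ∧ ∑ i, α i = 1}

/-- The face `F = {α ∈ Δ : α_{k−1} = 0}`. -/
def faceF (k : ℕ) : Set (E k) := {α ∈ simplex k | proj α (k - 1) = 0}

/-- `Δ' = Δ ∖ F`. -/
def simplex' (k : ℕ) : Set (E k) := simplex k \ faceF k

/-- `J(α) = ⌊α₀/α_{k−1}⌋`. -/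
noncomputable def Jfun {k : ℕ} (α : E k) : ℕ := ⌊proj α 0 / proj α (k - 1)⌋₊

/-- The map `K_n`. -/
noncomputable def Kmap {k : ℕ} (n : ℕ) (α : E k) : E k :=
  (WithLp.equiv 2 (Fin k → ℝ)).symm fun i =>
    if (i : ℕ) + 2 < k then proj α ((i : ℕ) + 1) / (1 - proj α 0)
    else if (i : ℕ) + 2 = k then (proj α 0 - n * proj α (k - 1)) / (1 - proj α 0)
    else ((n + 1) * proj α (k - 1) - proj α 0) / (1 - proj α 0)

/-- The continued-fraction map `K : Δ' → Δ'`, `K(α) = K_{J(α)}(α)`. -/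
noncomputable def Kstep {k : ℕ} (α : E k) : E k := Kmap (Jfun α) α

/-- The itinerary map `Φ(α)_r = J(K^r(α))`. -/
noncomputable def Phi {k : ℕ} (α : E k) : ℕ → ℕ := fun r => Jfun (Kstep^[r] α)

/-- The projective embedding `K_n^{-1} : Δ → Δ`. -/
noncomputable def Kinv {k : ℕ} (n : ℕ) (α : E k) : E k :=
  (WithLp.equiv 2 (Fin k → ℝ)).symm fun i =>
    (if (i : ℕ) = 0 then (n + 1) * proj α (k - 2) + n * proj α (k - 1)
      else if (i : ℕ) + 1 = k then proj α (k - 2) + proj α (k - 1)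
      else proj α ((i : ℕ) - 1)) /
      ((n + 1) * proj α (k - 2) + n * proj α (k - 1) + 1)

/-- `Υ_{n,r} = K_{n₀}^{-1} ∘ ⋯ ∘ K_{n_r}^{-1}`. -/
noncomputable def Ups {k : ℕ} (n : ℕ → ℕ) : ℕ → E k → E k
  | 0 => Kinv (n 0)
  | r + 1 => fun α => Ups n r (Kinv (n (r + 1)) α)

/-- `A_{n,r} = Υ_{n,r}(Δ)`. -/
noncomputable def Anr (k : ℕ) (n : ℕ → ℕ) (r : ℕ) : Set (E k) := Ups n r '' simplex k

/-- `F_{n,r} = Υ_{n,r}(F)`. -/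
noncomputable def Fnr (k : ℕ) (n : ℕ → ℕ) (r : ℕ) : Set (E k) := Ups n r '' faceF k

/-- Reverse-lexicographic strict order on `ℕ^ℕ`: `a < b` iff `a` exceeds `b`
at the first index where they differ. -/
def revLexLt (a b : ℕ → ℕ) : Prop := ∃ r, (∀ s, s < r → a s = b s) ∧ b r < a r

/-- The word to which the substitution `Λ_n` sends the digit `i`. -/
def lamWord (k n i : ℕ) : List ℕ :=
  if i + 2 < k then [i + 1]
  else if i + 2 = k then (k - 1) :: List.replicate (n + 1) 0
  else (k - 1) :: List.replicate n 0

/-- The substitution `Λ_n : Σ → Σ`. -/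
def lamSub (k n : ℕ) (w : Seq) : Seq := fun m =>
  (((List.range (m + 1)).map fun r => lamWord k n (w r)).flatten).getD m 0

/-- `Λ_{n,r} = Λ_{n₀} ∘ ⋯ ∘ Λ_{n_r}`. -/
def lamChain (k : ℕ) (n : ℕ → ℕ) : ℕ → Seq → Seq
  | 0 => lamSub k (n 0)
  | r + 1 => fun w => lamChain k n r (lamSub k (n (r + 1)) w)

/-- `Λ_{n₀} ∘ ⋯ ∘ Λ_{n_{R−1}}` for a finite list of indices. -/
def lamList (k : ℕ) : List ℕ → Seq → Seq
  | [], w => w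
  | a :: t, w => lamSub k a (lamList k t w)

/-- The constant sequence `(k−1)(k−1)(k−1)…`. -/
def topSeq (k : ℕ) : Seq := fun _ => k - 1

/-- The sequence `(k−1)000…`. -/
def baseSeq (k : ℕ) : Seq := fun m => if m = 0 then k - 1 else 0

/-- `S(n) = lim_{r→∞} Λ_{n,r}((k−1)(k−1)(k−1)…)` (limit in the product topology). -/
noncomputable def Sseq (k : ℕ) (n : ℕ → ℕ) : Seq :=
  limUnder atTop fun r => lamChain k n r (topSeq k)

/-- The compactified itinerary space `N`: sequences with values in `ℕ∞` such that
all entries from the first `∞` onwards equal `∞`.  Elements with no `∞` entry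
correspond to `ℕ^ℕ`; the others are the finite type elements `n₀…n_{R−1}∞`. -/
def NN : Type := {m : ℕ → ℕ∞ // ∀ r, m r = ⊤ → m (r + 1) = ⊤}

/-- Reverse-lexicographic strict order on `N` (`∞` counts as larger than every natural). -/
def nnLt (m n : NN) : Prop := ∃ r, (∀ s, s < r → m.1 s = n.1 s) ∧ n.1 r < m.1 r

/-- Reverse-lexicographic order on `N`. -/
def nnLe (m n : NN) : Prop := nnLt m n ∨ m = n

/-- The element of `N` determined by an element of `ℕ^ℕ`. -/
def toNN (g : ℕ → ℕ) : NN := ⟨fun r => (g r : ℕ∞), fun r h => absurd h (by simp)⟩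

/-- The itinerary `n₀ … n_{R−1} (n_R + 1) 0 0 0 …` (of rational type). -/
def ratSeq (f : ℕ → ℕ) (R : ℕ) : ℕ → ℕ := fun r =>
  if r < R then f r else if r = R then f R + 1 else 0

/-- The finite type element `n₀ … n_{R−1} n_R ∞` of `N`. -/
def finNN (f : ℕ → ℕ) (R : ℕ) : NN :=
  ⟨fun r => if r ≤ R then (f r : ℕ∞) else ⊤, by
    intro r h
    show (if r + 1 ≤ R then ((f (r + 1) : ℕ∞)) else ⊤) = ⊤
    have h' : (if r ≤ R then ((f r : ℕ∞)) else ⊤) = ⊤ := h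
    by_cases h1 : r ≤ R
    · rw [if_pos h1] at h'
      exact absurd h' (by simp)
    · rw [if_neg (by omega : ¬ r + 1 ≤ R)]⟩

/-- The extension of `S` to `N`. -/
noncomputable def SN (k : ℕ) (m : NN) : Seq :=
  if h : ∃ R, m.1 R = ⊤ then
    lamList k ((List.range (Nat.find h)).map fun r => (m.1 r).toNat) (baseSeq k)
  else Sseq k fun r => (m.1 r).toNat

/-- The metric `d(m,n) = 2^{−X(m,n)}` on `N`, where
`X(m,n) = r + min(m₀+⋯+m_r, n₀+⋯+n_r)` and `r` is the first index where `m,n` differ. -/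
noncomputable def dN (m n : NN) : ℝ :=
  if h : m = n then 0
  else
    have hex : ∃ r, m.1 r ≠ n.1 r := by
      by_contra hc
      push_neg at hc
      exact h (Subtype.ext (funext hc))
    (2 : ℝ) ^ (-(((Nat.find hex : ℕ) : ℤ) +
      ((min (∑ s ∈ Finset.range (Nat.find hex + 1), m.1 s)
            (∑ s ∈ Finset.range (Nat.find hex + 1), n.1 s)).toNat : ℤ)))

/-- The symbolic β-shift `X(w)`. -/
def Xset (k : ℕ) (w : Seq) : Set Seq :=
  {v | InSigma k v ∧ ∀ r, seqLe (shift^[r] v) w}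

/-- The digit frequency set `DF(w)` of the symbolic β-shift `X(w)`. -/
def DFw (k : ℕ) (w : Seq) : Set (E k) :=
  {α | α ∈ simplex k ∧ ∃ v ∈ Xset k w, HasDigitFreq k v α}

/-- `DF(n) = DF(S(n))` for `n ∈ ℕ^ℕ`. -/
noncomputable def DFn (k : ℕ) (n : ℕ → ℕ) : Set (E k) := DFw k (Sseq k n)

/-- `DF(n) = DF(S(n))` for `n ∈ N`. -/
noncomputable def DFN (k : ℕ) (m : NN) : Set (E k) := DFw k (SN k m)

/-- The infimax map `I = S ∘ Φ` on `Δ'`, extended by `I(α) = (k−1)000…` on `F`. -/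
noncomputable def Ifun (k : ℕ) (α : E k) : Seq :=
  if α ∈ simplex' k then Sseq k (Phi α) else baseSeq k

/-- The simplex `T_m = {α ∈ Δ : (m+1)α_{k−1} ≤ α₀}`. -/
def Tset (k m : ℕ) : Set (E k) :=
  {α ∈ simplex k | ((m : ℝ) + 1) * proj α (k - 1) ≤ proj α 0}

/-- The standard basis vector `e_i`. -/
noncomputable def evec (k i : ℕ) : E k :=
  (WithLp.equiv 2 (Fin k → ℝ)).symm fun j => if (j : ℕ) = i then 1 else 0

/-- The rational extreme points
`FE(n) = {Υ_{n,s}(e_{k−2}) : n_{s+t} ≠ 0 for some 1 ≤ t ≤ k−2}`. -/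
noncomputable def FEset (k : ℕ) (n : ℕ → ℕ) : Set (E k) :=
  {α | ∃ s, (∃ t, 1 ≤ t ∧ t ≤ k - 2 ∧ n (s + t) ≠ 0) ∧ α = Ups n s (evec k (k - 2))}

/-- The set `E(n)` of non-trivial extreme points of `DF(n)`:
extreme points other than `e₀,…,e_{k−2}`. -/
noncomputable def Eset (k : ℕ) (n : ℕ → ℕ) : Set (E k) :=
  Set.extremePoints ℝ (DFn k n) \ {α | ∃ i, i ≤ k - 2 ∧ α = evec k i}

/-- The fiber `Φ^{-1}(n) ⊆ Δ'`. -/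
noncomputable def PhiFiber (k : ℕ) (n : ℕ → ℕ) : Set (E k) :=
  {α ∈ simplex' k | Phi α = n}

/-- `f_β(x) = βx mod 1`. -/
noncomputable def fbeta (β x : ℝ) : ℝ := Int.fract (β * x)

/-- The digit sequence of the greedy β-expansion of `x`: `d_β(x)_r = ⌊β f_β^r(x)⌋`. -/
noncomputable def dbeta (β : ℝ) (x : ℝ) : Seq := fun r => ⌊β * (fbeta β)^[r] x⌋₊

/-- The digit frequency set `DF(β)` of β-expansions of points of `[0,1]`. -/
noncomputable def DFbeta (k : ℕ) (β : ℝ) : Set (E k) :=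
  {α | α ∈ simplex k ∧ ∃ x ∈ Set.Icc (0 : ℝ) 1, HasDigitFreq k (dbeta β x) α}

/-- The sequence `w_β`: if `d_β(1) = d₁…d_{r−1}d_r000…` with `d_r > 0` then `w_β`
is the infinite repetition of `d₁…d_{r−1}(d_r − 1)`; otherwise `w_β = d_β(1)`. -/
noncomputable def wbeta (β : ℝ) : Seq :=
  if h : ∃ r, dbeta β 1 r ≠ 0 ∧ ∀ s, r < s → dbeta β 1 s = 0 then
    fun m =>
      if m % (Nat.find h + 1) = Nat.find h then dbeta β 1 (Nat.find h) - 1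
      else dbeta β 1 (m % (Nat.find h + 1))
  else dbeta β 1

/-- `DF` extended to `[k−1,k]` by `DF(k−1) = F` and `DF(k) = Δ`. -/
noncomputable def DFext (k : ℕ) (β : ℝ) : Set (E k) :=
  if β ≤ (k : ℝ) - 1 then faceF k
  else if (k : ℝ) ≤ β then simplex k
  else DFbeta k β

/-- The mode-locking interval `I_{n₀…n_R}` determined by the word `f 0, …, f R`. -/
noncomputable def Iint (k : ℕ) (f : ℕ → ℕ) (R : ℕ) : Set ℝ :=
  {β | (k : ℝ) - 1 < β ∧ β < k ∧
    seqLe (Sseq k (ratSeq f R)) (wbeta β) ∧ seqLe (wbeta β) (SN k (finNN f R))}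

/-- The frequency vector of the first `s` digits of `w`. -/
noncomputable def freqVec (k : ℕ) (w : Seq) (s : ℕ) : E k :=
  (WithLp.equiv 2 (Fin k → ℝ)).symm fun i => (digitCount w (i : ℕ) s : ℝ) / (s : ℝ)


/-! ### Word-level substitutions -/

def lw (m : ℕ) (u : List ℕ) : List ℕ := u.flatMap (lamWord 3 m)

def Wd (n : ℕ → ℕ) : ℕ → List ℕ → List ℕ
  | 0, u => u
  | r + 1, u => Wd n r (lw (n r) u)

def WS (n : ℕ → ℕ) : ℕ → Seq → Seq
  | 0, w => w
  | r + 1, w => WS n r (lamSub 3 (n r) w)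

def IsPre (u : List ℕ) (w : Seq) : Prop := u = (List.range u.length).map w

lemma lamWord_zero (m : ℕ) : lamWord 3 m 0 = [1] := by simp [lamWord]
lemma lamWord_one (m : ℕ) : lamWord 3 m 1 = 2 :: List.replicate (m + 1) 0 := by simp [lamWord]
lemma lamWord_two (m : ℕ) : lamWord 3 m 2 = 2 :: List.replicate m 0 := by simp [lamWord]

lemma lamWord_length_pos (m i : ℕ) : 1 ≤ (lamWord 3 m i).length := by
  unfold lamWord
  split_ifs <;> simp

lemma lw_append (m : ℕ) (u v : List ℕ) : lw m (u ++ v) = lw m u ++ lw m v := by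
  simp [lw]

lemma length_le_lw (m : ℕ) (u : List ℕ) : u.length ≤ (lw m u).length := by
  induction u with
  | nil => simp
  | cons a t ih =>
    have : lw m (a :: t) = lamWord 3 m a ++ lw m t := by simp [lw]
    rw [this]
    have := lamWord_length_pos m a
    simp
    omega

lemma lamWord_lt (m i : ℕ) : ∀ x ∈ lamWord 3 m i, x < 3 := by
  intro x hx
  unfold lamWord at hx
  split_ifs at hx with h1 h2
  · simp at hx; omega
  · simp [List.mem_replicate] at hx
    rcases hx with h | h <;> omega
  · simp [List.mem_replicate] at hx
    rcases hx with h | h <;> omega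

lemma lw_lt (m : ℕ) (u : List ℕ) : ∀ x ∈ lw m u, x < 3 := by
  intro x hx
  unfold lw at hx
  rw [List.mem_flatMap] at hx
  obtain ⟨a, _, ha⟩ := hx
  exact lamWord_lt m a x ha

lemma Wd_append (n : ℕ → ℕ) (r : ℕ) (u v : List ℕ) :
    Wd n r (u ++ v) = Wd n r u ++ Wd n r v := by
  induction r generalizing u v with
  | zero => rfl
  | succ r ih => simp only [Wd, lw_append, ih]

lemma Wd_nil (n : ℕ → ℕ) (r : ℕ) : Wd n r [] = [] := by
  induction r with
  | zero => rfl
  | succ r ih => simpa [Wd, lw] using ih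

lemma Wd_flatMap (n : ℕ → ℕ) (r : ℕ) (u : List ℕ) :
    Wd n r u = u.flatMap (fun i => Wd n r [i]) := by
  induction u with
  | nil => simp [Wd_nil]
  | cons a t ih =>
    have : a :: t = [a] ++ t := rfl
    rw [this, Wd_append, ih]
    simp

lemma Wd_lt (n : ℕ → ℕ) (r : ℕ) (u : List ℕ) (hu : ∀ x ∈ u, x < 3) : ∀ x ∈ Wd n r u, x < 3 := by
  induction r generalizing u with
  | zero => exact hu
  | succ r ih => exact ih _ (lw_lt _ _)

lemma length_le_Wd (n : ℕ → ℕ) (r : ℕ) (u : List ℕ) : u.length ≤ (Wd n r u).length := by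
  induction r generalizing u with
  | zero => exact le_rfl
  | succ r ih => exact (length_le_lw _ _).trans (ih _)

lemma lamSub_apply (m : ℕ) (w : Seq) (i : ℕ) :
    lamSub 3 m w i = (lw m ((List.range (i + 1)).map w)).getD i 0 := by
  unfold lamSub lw
  rw [List.flatMap_map]
  rfl

lemma lw_getD (m : ℕ) (w : Seq) (a b i : ℕ) (hab : a ≤ b)
    (ha : i < (lw m ((List.range a).map w)).length) :
    (lw m ((List.range b).map w)).getD i 0 = (lw m ((List.range a).map w)).getD i 0 := by
  obtain ⟨c, rfl⟩ := Nat.exists_eq_add_of_le hab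
  rw [List.range_add, List.map_append, lw_append]
  rw [List.getD_append _ _ _ _ ha]

lemma isPre_iff (u : List ℕ) (w : Seq) :
    IsPre u w ↔ ∀ i, i < u.length → u.getD i 0 = w i := by
  unfold IsPre
  constructor
  · intro h i hi
    rw [h]
    rw [List.getD_eq_getElem _ _ (by simpa using hi)]
    simp
  · intro h
    apply List.ext_getElem
    · simp
    · intro i h1 h2
      have := h i h1
      rw [List.getD_eq_getElem _ _ h1] at this
      simp [this]

lemma IsPre.lw {u : List ℕ} {w : Seq} (m : ℕ) (h : IsPre u w) :
    IsPre (lw m u) (lamSub 3 m w) := by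
  rw [isPre_iff]
  intro i hi
  rw [lamSub_apply]
  have h' : u = (List.range u.length).map w := h
  rw [h'] at hi ⊢
  have h2 : i < (BetaDF.lw m ((List.range (i+1)).map w)).length := by
    have := length_le_lw m ((List.range (i+1)).map w)
    simp at this
    omega
  rcases le_total (i+1) u.length with hle | hle
  · exact lw_getD m w _ _ i hle h2
  · exact (lw_getD m w _ _ i hle hi).symm

lemma IsPre.Wd {u : List ℕ} {w : Seq} (n : ℕ → ℕ) (r : ℕ) (h : IsPre u w) :
    IsPre (Wd n r u) (WS n r w) := by
  induction r generalizing u w with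
  | zero => exact h
  | succ r ih => exact ih (h.lw _)

lemma lamChain_eq (n : ℕ → ℕ) (r : ℕ) (w : Seq) : lamChain 3 n r w = WS n (r+1) w := by
  induction r generalizing w with
  | zero => rfl
  | succ r ih => exact ih _

lemma lamList_append (l : List ℕ) (a : ℕ) (w : Seq) :
    lamList 3 (l ++ [a]) w = lamList 3 l (lamSub 3 a w) := by
  induction l with
  | nil => rfl
  | cons b t ih => simp only [List.cons_append, lamList, ih]

lemma lamList_eq (f : ℕ → ℕ) (R : ℕ) (w : Seq) :
    lamList 3 ((List.range R).map f) w = WS f R w := by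
  induction R generalizing w with
  | zero => rfl
  | succ R ih =>
    rw [List.range_succ, List.map_append, List.map_singleton, lamList_append, ih]
    rfl

/-- The word `Λ_{n,r-1}(2)`. -/
def Cw (n : ℕ → ℕ) (r : ℕ) : List ℕ := Wd n r [2]

lemma Cw_succ (n : ℕ → ℕ) (r : ℕ) :
    Cw n (r+1) = Cw n r ++ Wd n r (List.replicate (n r) 0) := by
  unfold Cw
  rw [← Wd_append]
  simp [Wd, lw, lamWord_two]

lemma Cw_pfx_mono (n : ℕ → ℕ) {r s : ℕ} (h : r ≤ s) : Cw n r <+: Cw n s := by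
  induction s, h using Nat.le_induction with
  | base => exact List.prefix_rfl
  | succ s _ ih => exact ih.trans (by rw [Cw_succ]; exact List.prefix_append _ _)

lemma Wd_add (n : ℕ → ℕ) (r s : ℕ) (u : List ℕ) :
    Wd n (r + s) u = Wd n r (Wd (fun j => n (r + j)) s u) := by
  induction s generalizing u with
  | zero => rfl
  | succ s ih => exact ih _

lemma Cw_unbounded (n : ℕ → ℕ) (hn : ∀ R, ∃ r, R ≤ r ∧ n r ≠ 0) (p : ℕ) :
    ∃ R, ∀ r, R ≤ r → p < (Cw n r).length := by
  induction p with
  | zero =>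
    refine ⟨0, fun r _ => ?_⟩
    have := length_le_Wd n r [2]
    simp at this
    unfold Cw
    omega
  | succ p ih =>
    obtain ⟨R, hR⟩ := ih
    obtain ⟨r, hr, hr0⟩ := hn R
    refine ⟨r + 1, fun s hs => ?_⟩
    have h1 := (Cw_pfx_mono n hs).length_le
    have h2 := hR r hr
    rw [Cw_succ, List.length_append] at h1
    have h3 := length_le_Wd n r (List.replicate (n r) 0)
    rw [List.length_replicate] at h3
    omega

lemma IsPre.of_pfx_word {u v : List ℕ} {w : Seq} (h : IsPre v w) (huv : u <+: v) : IsPre u w := by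
  rw [isPre_iff] at *
  intro i hi
  rw [← h i (lt_of_lt_of_le hi huv.length_le)]
  obtain ⟨t, rfl⟩ := huv
  rw [List.getD_append _ _ _ _ hi]

lemma isPre_two {w : Seq} (h : w 0 = 2) : IsPre [2] w := by
  simp [IsPre, h]

lemma Sseq_pre (n : ℕ → ℕ) (hn : ∀ R, ∃ r, R ≤ r ∧ n r ≠ 0) (r : ℕ) :
    IsPre (Cw n r) (Sseq 3 n) := by
  have hpre : ∀ r, IsPre (Cw n (r+1)) (lamChain 3 n r (topSeq 3)) := by
    intro r
    rw [lamChain_eq]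
    exact (isPre_two rfl).Wd n (r+1)
  choose R hR using Cw_unbounded n hn
  let w : Seq := fun p => (Cw n (R p)).getD p 0
  have hval : ∀ p r, p < (Cw n r).length → (Cw n r).getD p 0 = w p := by
    intro p r hp
    rcases le_total r (R p) with h | h
    · obtain ⟨t, ht⟩ := Cw_pfx_mono n h
      simp only [w]
      rw [← ht, List.getD_append _ _ _ _ hp]
    · obtain ⟨t, ht⟩ := Cw_pfx_mono n h
      simp only [w]
      rw [← ht, List.getD_append _ _ _ _ (hR p _ le_rfl)]
  have hlim : Tendsto (fun r => lamChain 3 n r (topSeq 3)) atTop (𝓝 w) := by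
    rw [tendsto_pi_nhds]
    intro p
    apply tendsto_const_nhds.congr'
    filter_upwards [eventually_ge_atTop (R p)] with r hr
    have hl := hR p (r+1) (by omega)
    rw [← hval p (r+1) hl]
    exact (isPre_iff _ _).1 (hpre r) p hl
  have hS : Sseq 3 n = w := hlim.limUnder_eq
  rw [hS, isPre_iff]
  intro p hp
  exact hval p r hp

lemma seqLe_eq (n : ℕ → ℕ) (hn : ∀ R, ∃ r, R ≤ r ∧ n r ≠ 0) (w : Seq)
    (hle : seqLe (SN 3 (toNN n)) w)
    (hmax : ∀ m : NN, seqLe (SN 3 m) w → nnLe m (toNN n)) : Sseq 3 n = w := by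
  have hSN : SN 3 (toNN n) = Sseq 3 n := by
    unfold SN
    rw [dif_neg]
    · simp [toNN]
    · simp [toNN]
  rw [hSN] at hle
  rcases hle with ⟨p, hp1, hp2⟩ | h
  swap
  · exact h
  exfalso
  obtain ⟨R, hR⟩ := Cw_unbounded n hn p
  obtain ⟨r, hr, hr0⟩ := hn R
  let f : ℕ → ℕ := Function.update n r (n r - 1)
  have hex : ∃ R, (finNN f r).1 R = ⊤ := ⟨r+1, by simp [finNN]⟩
  have hfind : Nat.find hex = r + 1 := by
    rw [Nat.find_eq_iff]
    refine ⟨by simp [finNN], fun j hj => ?_⟩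
    have : j ≤ r := by omega
    simp [finNN, this]
  have hlist : ((List.range (r+1)).map fun j => ((finNN f r).1 j).toNat) =
      (List.range (r+1)).map f := by
    apply List.map_congr_left
    intro j hj
    have : j ≤ r := by simpa [Nat.lt_succ_iff] using hj
    simp [finNN, this]
  have hS' : SN 3 (finNN f r) = WS f (r+1) (baseSeq 3) := by
    unfold SN
    rw [dif_pos hex, hfind, hlist, lamList_eq]
  have hWS : ∀ j ≤ r, ∀ u, Wd f j u = Wd n j u := by
    intro j hj
    induction j with
    | zero => intro u; rfl
    | succ j ih =>
      intro u
      have : f j = n j := Function.update_of_ne (by omega) _ _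
      simp only [Wd, this]
      exact ih (by omega) _
  have hpre : IsPre (Cw n r) (SN 3 (finNN f r)) := by
    rw [hS']
    unfold Cw
    rw [← hWS r le_rfl]
    refine IsPre.Wd (w := lamSub 3 (f r) (baseSeq 3)) f r (isPre_two ?_)
    rw [lamSub_apply]
    simp [lw, baseSeq, lamWord_two]
  have hagree : ∀ s, s ≤ p → SN 3 (finNN f r) s = Sseq 3 n s := by
    intro s hs
    have hl : s < (Cw n r).length := lt_of_le_of_lt hs (hR r hr)
    rw [← (isPre_iff _ _).1 hpre s hl, ← (isPre_iff _ _).1 (Sseq_pre n hn r) s hl]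
  have hlt : seqLe (SN 3 (finNN f r)) w := by
    left
    refine ⟨p, fun s hs => ?_, ?_⟩
    · rw [hagree s hs.le, hp1 s hs]
    · rw [hagree p le_rfl]; exact hp2
  have hfr : f r = n r - 1 := by simp [f]
  have hbef : ∀ s, s < r → f s = n s := by
    intro s hs
    exact Function.update_of_ne (by omega) _ _
  rcases hmax _ hlt with ⟨t, ht1, ht2⟩ | h
  · rcases lt_trichotomy t r with h | h | h
    · have : (finNN f r).1 t = (f t : ℕ∞) := by simp [finNN, h.le]
      rw [this, hbef t h] at ht2
      exact lt_irrefl _ ht2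
    · subst h
      have : (finNN f t).1 t = (f t : ℕ∞) := by simp [finNN]
      rw [this, hfr] at ht2
      have h3 : ((n t : ℕ) : ℕ∞) < ((n t - 1 : ℕ) : ℕ∞) := ht2
      rw [Nat.cast_lt] at h3
      omega
    · have h3 := ht1 r h
      have : (finNN f r).1 r = (f r : ℕ∞) := by simp [finNN]
      rw [this, hfr] at h3
      have h3 : ((n r - 1 : ℕ) : ℕ∞) = ((n r : ℕ) : ℕ∞) := h3
      rw [Nat.cast_inj] at h3
      omega
  · have h3 : (finNN f r).1 (r+1) = (toNN n).1 (r+1) := by rw [h]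
    simp [finNN, toNN] at h3

/-! ### Linear algebra -/

abbrev V3 : Type := Fin 3 → ℝ

def Amat (m : ℕ) : V3 →ₗ[ℝ] V3 where
  toFun y := ![(m + 1) * y 1 + m * y 2, y 0, y 1 + y 2]
  map_add' x y := by ext i; fin_cases i <;> simp <;> ring
  map_smul' c x := by ext i; fin_cases i <;> simp <;> ring

def Tmat (m : ℕ) : V3 →ₗ[ℝ] V3 where
  toFun x := ![x 1, x 0 - m * x 2, (m + 1) * x 2 - x 0]
  map_add' x y := by ext i; fin_cases i <;> simp <;> ring
  map_smul' c x := by ext i; fin_cases i <;> simp <;> ring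

lemma Amat_apply (m : ℕ) (y : V3) : Amat m y = ![(m + 1) * y 1 + m * y 2, y 0, y 1 + y 2] := rfl
lemma Tmat_apply (m : ℕ) (x : V3) : Tmat m x = ![x 1, x 0 - m * x 2, (m + 1) * x 2 - x 0] := rfl

lemma Tmat_Amat (m : ℕ) (y : V3) : Tmat m (Amat m y) = y := by
  rw [Tmat_apply, Amat_apply]
  ext i; fin_cases i <;> simp <;> ring

lemma Amat_Tmat (m : ℕ) (y : V3) : Amat m (Tmat m y) = y := by
  rw [Tmat_apply, Amat_apply]
  ext i; fin_cases i <;> simp <;> ring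

def AA (n : ℕ → ℕ) : ℕ → V3 →ₗ[ℝ] V3
  | 0 => LinearMap.id
  | r + 1 => (AA n r).comp (Amat (n r))

def TT (n : ℕ → ℕ) : ℕ → V3 →ₗ[ℝ] V3
  | 0 => LinearMap.id
  | r + 1 => (Tmat (n r)).comp (TT n r)

lemma TT_succ (n : ℕ → ℕ) (r : ℕ) (x : V3) : TT n (r+1) x = Tmat (n r) (TT n r x) := rfl
lemma AA_succ (n : ℕ → ℕ) (r : ℕ) (x : V3) : AA n (r+1) x = AA n r (Amat (n r) x) := rfl

lemma TT_AA (n : ℕ → ℕ) (r : ℕ) (y : V3) : TT n r (AA n r y) = y := by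
  induction r generalizing y with
  | zero => rfl
  | succ r ih => rw [TT_succ, AA_succ, ih, Tmat_Amat]

lemma AA_TT (n : ℕ → ℕ) (r : ℕ) (y : V3) : AA n r (TT n r y) = y := by
  induction r generalizing y with
  | zero => rfl
  | succ r ih => rw [TT_succ, AA_succ, Amat_Tmat, ih]

lemma Amat_nonneg (m : ℕ) (y : V3) (hy : 0 ≤ y) : 0 ≤ Amat m y := by
  rw [Amat_apply]
  have h0 := hy 0
  have h1 := hy 1
  have h2 := hy 2
  simp only [Pi.zero_apply] at h0 h1 h2
  intro i; fin_cases i <;> simp <;> positivity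

lemma TT_nonneg_of_succ (n : ℕ → ℕ) (r : ℕ) (x : V3) (h : 0 ≤ TT n (r+1) x) : 0 ≤ TT n r x := by
  have := Amat_nonneg (n r) _ h
  rwa [TT_succ, Amat_Tmat] at this

lemma TT_nonneg_of_le (n : ℕ → ℕ) {r s : ℕ} (hrs : r ≤ s) (x : V3) (h : 0 ≤ TT n s x) :
    0 ≤ TT n r x := by
  induction s, hrs using Nat.le_induction with
  | base => exact h
  | succ s _ ih => exact ih (TT_nonneg_of_succ n s x h)

def e0 : V3 := ![1, 0, 0]
def e1 : V3 := ![0, 1, 0]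
def e2 : V3 := ![0, 0, 1]

lemma vec_decomp (y : V3) : y = y 0 • e0 + y 1 • e1 + y 2 • e2 := by
  ext i; fin_cases i <;> simp [e0, e1, e2]

def bv (n : ℕ → ℕ) (r : ℕ) : V3 := AA n r e1
def cv (n : ℕ → ℕ) (r : ℕ) : V3 := AA n r e2

lemma AA_e0_succ (n : ℕ → ℕ) (r : ℕ) : AA n (r+1) e0 = bv n r := by
  rw [AA_succ, bv]
  congr 1
  rw [Amat_apply]; ext i; fin_cases i <;> simp [e0, e1]

lemma cv_succ (n : ℕ → ℕ) (r : ℕ) : cv n (r+1) = (n r : ℝ) • AA n r e0 + cv n r := by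
  rw [cv, cv, AA_succ, ← map_smul, ← map_add]
  congr 1
  rw [Amat_apply]; ext i; fin_cases i <;> simp [e0, e2]

lemma bv_succ (n : ℕ → ℕ) (r : ℕ) : bv n (r+1) = cv n (r+1) + AA n r e0 := by
  rw [cv, bv, AA_succ, AA_succ, ← map_add]
  congr 1
  rw [Amat_apply, Amat_apply]; ext i; fin_cases i <;> simp [e0, e1, e2]

lemma bv_add_two (n : ℕ → ℕ) (r : ℕ) : bv n (r+2) = cv n (r+2) + bv n r := by
  rw [bv_succ, AA_e0_succ]

def sm : V3 →ₗ[ℝ] ℝ where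
  toFun x := x 0 + x 1 + x 2
  map_add' x y := by simp; ring
  map_smul' c x := by simp; ring

lemma sm_apply (x : V3) : sm x = x 0 + x 1 + x 2 := rfl

lemma AA_nonneg (n : ℕ → ℕ) (r : ℕ) (y : V3) (hy : 0 ≤ y) : 0 ≤ AA n r y := by
  induction r generalizing y with
  | zero => exact hy
  | succ r ih => exact ih _ (Amat_nonneg _ _ hy)

lemma sm_AA_ge (n : ℕ → ℕ) (r : ℕ) (y : V3) (hy : 0 ≤ y) : sm y ≤ sm (AA n r y) := by
  induction r generalizing y with
  | zero => exact le_rfl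
  | succ r ih =>
    refine le_trans ?_ (ih _ (Amat_nonneg (n r) _ hy))
    have h0 := hy 0
    have h1 := hy 1
    have h2 := hy 2
    simp only [Pi.zero_apply] at h0 h1 h2
    rw [sm_apply, sm_apply, Amat_apply]
    simp
    have : 0 ≤ ((n r : ℝ) + 1) * y 1 + n r * y 2 := by positivity
    linarith

lemma e0_nonneg : (0:V3) ≤ e0 := by intro i; fin_cases i <;> simp [e0]
lemma e1_nonneg : (0:V3) ≤ e1 := by intro i; fin_cases i <;> simp [e1]
lemma e2_nonneg : (0:V3) ≤ e2 := by intro i; fin_cases i <;> simp [e2]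

lemma sm_a (n : ℕ → ℕ) (r : ℕ) : 1 ≤ sm (AA n r e0) := by
  have := sm_AA_ge n r e0 e0_nonneg
  rw [sm_apply] at this; simpa [e0] using this
lemma sm_b (n : ℕ → ℕ) (r : ℕ) : 1 ≤ sm (bv n r) := by
  have := sm_AA_ge n r e1 e1_nonneg
  rw [sm_apply] at this; simpa [e1, bv] using this
lemma sm_c (n : ℕ → ℕ) (r : ℕ) : 1 ≤ sm (cv n r) := by
  have := sm_AA_ge n r e2 e2_nonneg
  rw [sm_apply] at this; simpa [e2, cv] using this

lemma sm_b_ge (n : ℕ → ℕ) (r : ℕ) : (r : ℝ) / 2 ≤ sm (bv n r) := by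
  induction r using Nat.strong_induction_on with
  | _ r ih =>
    match r, ih with
    | 0, _ => have := sm_b n 0; simp; linarith
    | 1, _ => have := sm_b n 1; norm_num; linarith
    | r + 2, ih =>
      rw [bv_add_two, map_add]
      have h1 := ih r (by omega)
      have h2 := sm_c n (r+2)
      push_cast
      linarith

/-- The limiting set of directions. -/
def PP (n : ℕ → ℕ) : Set V3 := {x | sm x = 1 ∧ ∀ r, 0 ≤ TT n r x}

lemma PP_pos (n : ℕ → ℕ) (x : V3) (hx : x ∈ PP n) (r : ℕ) (lam : V3 →ₗ[ℝ] ℝ)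
    (ha : lam (AA n r e0) ≤ 0) (hb : lam (bv n r) ≤ 0) (hc : lam (cv n r) ≤ 0) : lam x ≤ 0 := by
  have h := hx.2 r
  rw [← AA_TT n r x, vec_decomp (TT n r x)]
  simp only [map_add, map_smul, smul_eq_mul]
  have h0 := h 0
  have h1 := h 1
  have h2 := h 2
  simp only [Pi.zero_apply] at h0 h1 h2
  have := mul_nonpos_of_nonneg_of_nonpos h0 ha
  have := mul_nonpos_of_nonneg_of_nonpos h1 hb
  have := mul_nonpos_of_nonneg_of_nonpos h2 hc
  unfold bv cv at *
  linarith

lemma hull (n : ℕ → ℕ) (x : V3) (hx : x ∈ PP n) (lam : V3 →ₗ[ℝ] ℝ) (hl : 0 < lam x) (R : ℕ) :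
    ∃ r, R ≤ r ∧ 0 < lam (cv n r) := by
  by_contra hcon
  push Not at hcon
  set C : ℝ := max (lam (bv n R)) (lam (bv n (R+1))) with hC
  have hbC : ∀ j, lam (bv n (R + j)) ≤ C := by
    intro j
    induction j using Nat.strong_induction_on with
    | _ j ih =>
      match j, ih with
      | 0, _ => exact le_max_left _ _
      | 1, _ => exact le_max_right _ _
      | j + 2, ih =>
        have h1 := ih j (by omega)
        have h2 := hcon (R + j + 2) (by omega)
        rw [show R + (j + 2) = R + j + 2 by ring, bv_add_two, map_add]
        linarith
  set η := lam x / 2 with hη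
  have hηpos : 0 < η := by positivity
  let lam' : V3 →ₗ[ℝ] ℝ := lam - η • sm
  have hl' : ∀ v, lam' v = lam v - η * sm v := by intro v; simp [lam']
  obtain ⟨N, hN⟩ := exists_nat_gt (2 * C / η)
  have hNb : ∀ r, N ≤ r → C ≤ η * sm (bv n r) := by
    intro r hr
    have h1 := sm_b_ge n r
    have h2 : (N : ℝ) ≤ r := by exact_mod_cast hr
    have h3 : 2 * C / η < r := lt_of_lt_of_le hN h2
    rw [div_lt_iff₀ hηpos] at h3
    nlinarith
  have hbneg : ∀ r, R + N ≤ r → lam' (bv n r) ≤ 0 := by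
    intro r hr
    rw [hl']
    have h1 := hNb r (by omega)
    have h2 := hbC (r - R)
    rw [show R + (r - R) = r by omega] at h2
    linarith
  have := PP_pos n x hx (R + N + 1) lam' (by rw [AA_e0_succ]; exact hbneg _ le_rfl)
    (hbneg _ (by omega)) (by
      rw [hl']
      have h1 := hcon (R + N + 1) (by omega)
      have h2 := sm_c n (R + N + 1)
      nlinarith)
  rw [hl', hx.1] at this
  linarith

def det3 (x y z : V3) : ℝ :=
  x 0 * (y 1 * z 2 - y 2 * z 1) - x 1 * (y 0 * z 2 - y 2 * z 0) + x 2 * (y 0 * z 1 - y 1 * z 0)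

lemma det3_TT (n : ℕ → ℕ) (r : ℕ) (x y z : V3) :
    |det3 (TT n r x) (TT n r y) (TT n r z)| = |det3 x y z| := by
  induction r with
  | zero => rfl
  | succ r ih =>
    rw [← ih, ← abs_neg]
    congr 1
    simp only [TT_succ, Tmat_apply, det3]
    simp
    ring

lemma PP_bound (n : ℕ → ℕ) (x : V3) (hx : x ∈ PP n) (r : ℕ) :
    0 ≤ TT n r x 0 ∧ 0 ≤ TT n r x 1 ∧ 0 ≤ TT n r x 2 ∧ TT n r x 0 ≤ 1 ∧
    TT n r x 2 ≤ 1 ∧ TT n r x 1 * sm (bv n r) ≤ 1 := by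
  have h := hx.2 r
  have hs : sm (AA n r (TT n r x)) = 1 := by rw [AA_TT]; exact hx.1
  rw [vec_decomp (TT n r x)] at hs
  simp only [map_add, map_smul, smul_eq_mul] at hs
  have h0 := h 0
  have h1 := h 1
  have h2 := h 2
  simp only [Pi.zero_apply] at h0 h1 h2
  have ha := sm_a n r
  have hb := sm_b n r
  have hc := sm_c n r
  unfold bv cv at *
  refine ⟨h0, h1, h2, ?_, ?_, ?_⟩ <;> nlinarith [mul_nonneg h0 (sub_nonneg.2 ha),
    mul_nonneg h1 (sub_nonneg.2 hb), mul_nonneg h2 (sub_nonneg.2 hc)]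

lemma det_aux (a b c B : ℝ) (ha : 0 ≤ a) (hb : 0 ≤ b) (hc : 0 ≤ c) (ha1 : a ≤ 1) (hc1 : c ≤ 1)
    (hB : 0 ≤ B) (hbB : b * B ≤ 1) : 0 ≤ a * b * c * B ∧ a * b * c * B ≤ 1 := by
  refine ⟨by positivity, ?_⟩
  have h1 : a * c ≤ 1 := mul_le_one₀ ha1 hc hc1
  calc a * b * c * B = (a * c) * (b * B) := by ring
    _ ≤ 1 := mul_le_one₀ h1 (by positivity) hbB

lemma PP_det (n : ℕ → ℕ) (x y z : V3) (hx : x ∈ PP n) (hy : y ∈ PP n) (hz : z ∈ PP n) :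
    det3 x y z = 0 := by
  have key : ∀ r, |det3 x y z| * sm (bv n r) ≤ 3 := by
    intro r
    rw [← det3_TT n r]
    obtain ⟨x0, x1, x2, x3, x4, x5⟩ := PP_bound n x hx r
    obtain ⟨y0, y1, y2, y3, y4, y5⟩ := PP_bound n y hy r
    obtain ⟨z0, z1, z2, z3, z4, z5⟩ := PP_bound n z hz r
    have hB : 0 ≤ sm (bv n r) := by linarith [sm_b n r]
    rw [← abs_of_nonneg hB, ← abs_mul]
    have p1 := det_aux _ _ _ _ x0 y1 z2 x3 z4 hB y5
    have p2 := det_aux _ _ _ _ x0 z1 y2 x3 y4 hB z5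
    have p3 := det_aux _ _ _ _ y0 x1 z2 y3 z4 hB x5
    have p4 := det_aux _ _ _ _ z0 x1 y2 z3 y4 hB x5
    have p5 := det_aux _ _ _ _ y0 z1 x2 y3 x4 hB z5
    have p6 := det_aux _ _ _ _ z0 y1 x2 z3 x4 hB y5
    rw [abs_le, det3]
    constructor <;> linarith
  by_contra hne
  have hpos : 0 < |det3 x y z| := abs_pos.2 hne
  obtain ⟨N, hN⟩ := exists_nat_gt (6 / |det3 x y z|)
  rw [div_lt_iff₀ hpos] at hN
  have h1 := key N
  have h2 := sm_b_ge n N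
  nlinarith

lemma PP_inj (n : ℕ → ℕ) (x q y : V3) (hx : x ∈ PP n) (hq : q ∈ PP n) (hy : y ∈ PP n)
    (i : Fin 3) (hi : x i ≠ q i) (hxy : y i = x i) : y = x := by
  have hd := PP_det n x q y hx hq hy
  have sx := hx.1
  have sq := hq.1
  have sy := hy.1
  rw [sm_apply] at sx sq sy
  have key : ∀ j, (q i - x i) * (y j - x j) = 0 := by
    have e1 : x 2 = 1 - x 0 - x 1 := by linarith
    have e2 : q 2 = 1 - q 0 - q 1 := by linarith
    have e3 : y 2 = 1 - y 0 - y 1 := by linarith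
    have hd' : (q 0 - x 0) * (y 1 - x 1) = (q 1 - x 1) * (y 0 - x 0) := by
      rw [det3, e1, e2, e3] at hd
      linarith
    have gen : ∀ i j : Fin 3, (q i - x i) * (y j - x j) = (q j - x j) * (y i - x i) := by
      intro i j
      fin_cases i <;> fin_cases j <;> simp [e1, e2, e3] <;> linarith
    intro j
    rw [gen, hxy]
    ring
  ext j
  have := key j
  rcases mul_eq_zero.1 this with h | h
  · exact absurd (by linarith) hi
  · linarith

/-! ### Counting -/

def cnt (u : List ℕ) : V3 := fun i => (u.count (i : ℕ) : ℝ)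

lemma cnt_nil : cnt [] = 0 := by ext i; simp [cnt]

lemma cnt_append (u v : List ℕ) : cnt (u ++ v) = cnt u + cnt v := by
  ext i; simp [cnt]

lemma cnt_nonneg (u : List ℕ) : 0 ≤ cnt u := by
  intro i; simp [cnt]

lemma cnt_le (u : List ℕ) (i : Fin 3) : cnt u i ≤ u.length := by
  simp only [cnt]
  exact_mod_cast List.count_le_length

lemma cnt_lamWord (m a : ℕ) (ha : a < 3) : cnt (lamWord 3 m a) = Amat m (cnt [a]) := by
  rw [Amat_apply]
  interval_cases a
  · rw [lamWord_zero]; ext i; fin_cases i <;> simp [cnt]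
  · rw [lamWord_one]; ext i; fin_cases i <;> simp [cnt, List.count_replicate, List.count_cons]
  · rw [lamWord_two]; ext i; fin_cases i <;> simp [cnt, List.count_replicate, List.count_cons]

lemma cnt_lw (m : ℕ) (u : List ℕ) (hu : ∀ x ∈ u, x < 3) : cnt (lw m u) = Amat m (cnt u) := by
  induction u with
  | nil => simp [lw, cnt_nil]
  | cons a t ih =>
    have h1 : lw m (a :: t) = lamWord 3 m a ++ lw m t := by simp [lw]
    have h2 : a :: t = [a] ++ t := rfl
    rw [h1, h2, cnt_append, cnt_append, map_add, cnt_lamWord m a (hu a (by simp)),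
      ih (fun x hx => hu x (by simp [hx]))]

lemma cnt_Wd (n : ℕ → ℕ) (r : ℕ) (u : List ℕ) (hu : ∀ x ∈ u, x < 3) :
    cnt (Wd n r u) = AA n r (cnt u) := by
  induction r generalizing u with
  | zero => rfl
  | succ r ih =>
    rw [AA_succ, ← cnt_lw _ _ hu]
    exact ih _ (lw_lt _ _)

lemma cnt_Cw (n : ℕ → ℕ) (r : ℕ) : cnt (Cw n r) = cv n r := by
  rw [Cw, cnt_Wd _ _ _ (by simp), cv]
  congr 1
  ext i; fin_cases i <;> simp [cnt, e2]

lemma sm_cnt (u : List ℕ) (hu : ∀ x ∈ u, x < 3) : sm (cnt u) = u.length := by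
  induction u with
  | nil => simp [cnt_nil]
  | cons a t ih =>
    have h2 : a :: t = [a] ++ t := rfl
    rw [h2, cnt_append, map_add, ih (fun x hx => hu x (by simp [hx]))]
    have ha := hu a (by simp)
    have : sm (cnt [a]) = 1 := by
      rw [sm_apply]
      interval_cases a <;> simp [cnt]
    rw [this]
    simp
    ring

lemma digitCount_eq (w : Seq) (i s : ℕ) :
    digitCount w i s = ((List.range s).map w).count i := by
  induction s with
  | zero => simp [digitCount]
  | succ s ih =>
    rw [List.range_succ, List.map_append, List.count_append, ← ih]
    unfold digitCount
    rw [Finset.range_add_one, Finset.filter_insert]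
    split_ifs with h
    · rw [Finset.card_insert_of_notMem (by simp)]
      simp [h]
    · simp [List.count_singleton, h]

lemma prefix_decomp (f : ℕ → List ℕ) (B : ℕ) (u p : List ℕ) (hB : ∀ x ∈ u, (f x).length ≤ B)
    (hp : p <+: u.flatMap f) :
    ∃ u' rem, u' <+: u ∧ p = u'.flatMap f ++ rem ∧ rem.length ≤ B := by
  induction u generalizing p with
  | nil =>
    simp at hp
    exact ⟨[], [], by simp, by simp [hp], by simp⟩
  | cons a t ih =>
    rw [List.flatMap_cons] at hp
    rcases le_total p.length (f a).length with h | h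
    · exact ⟨[], p, by simp, by simp, h.trans (hB a (by simp))⟩
    · obtain ⟨p', rfl⟩ := List.prefix_of_prefix_length_le (List.prefix_append (f a) _) hp h
      rw [List.prefix_append_right_inj] at hp
      obtain ⟨u', rem, h1, h2, h3⟩ := ih p' (fun x hx => hB x (by simp [hx])) hp
      refine ⟨a :: u', rem, ?_, ?_, h3⟩
      · exact List.cons_prefix_cons.2 ⟨rfl, h1⟩
      · simp [h2]

def pw (w : Seq) (s : ℕ) : List ℕ := (List.range s).map w

lemma pw_length (w : Seq) (s : ℕ) : (pw w s).length = s := by simp [pw]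

lemma pw_pfx_mono (w : Seq) {s t : ℕ} (h : s ≤ t) : pw w s <+: pw w t := by
  obtain ⟨c, rfl⟩ := Nat.exists_eq_add_of_le h
  unfold pw
  rw [List.range_add, List.map_append]
  exact List.prefix_append _ _

lemma Cw_eq_pw {n : ℕ → ℕ} (hn : ∀ R, ∃ r, R ≤ r ∧ n r ≠ 0) (r : ℕ) :
    Cw n r = pw (Sseq 3 n) (Cw n r).length := Sseq_pre n hn r

lemma pw_lt {n : ℕ → ℕ} (hn : ∀ R, ∃ r, R ≤ r ∧ n r ≠ 0) (s : ℕ) :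
    ∀ x ∈ pw (Sseq 3 n) s, x < 3 := by
  obtain ⟨R, hR⟩ := Cw_unbounded n hn s
  have h := pw_pfx_mono (Sseq 3 n) (hR R le_rfl).le
  rw [← Cw_eq_pw hn R] at h
  intro x hx
  exact Wd_lt n R [2] (by simp) x (h.subset hx)

lemma pw_decomp {n : ℕ → ℕ} (hn : ∀ R, ∃ r, R ≤ r ∧ n r ≠ 0) (r : ℕ) :
    ∃ B : ℕ, ∀ s, ∃ y rem : V3, 0 ≤ y ∧ 0 ≤ rem ∧ (∀ i, rem i ≤ B) ∧
      cnt (pw (Sseq 3 n) s) = AA n r y + rem := by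
  refine ⟨(Wd n r [0]).length + (Wd n r [1]).length + (Wd n r [2]).length, fun s => ?_⟩
  obtain ⟨R, hR⟩ := Cw_unbounded n hn s
  have h := pw_pfx_mono (Sseq 3 n) (hR (r + R) (by omega)).le
  rw [← Cw_eq_pw hn, Cw, Wd_add, Wd_flatMap] at h
  have hlt := Wd_lt (fun j => n (r + j)) R [2] (by simp)
  obtain ⟨u', rem, h1, h2, h3⟩ := prefix_decomp _
    ((Wd n r [0]).length + (Wd n r [1]).length + (Wd n r [2]).length) _ _ (by
      intro x hx
      have := hlt x hx
      interval_cases x <;> omega) h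
  refine ⟨cnt u', cnt rem, cnt_nonneg _, cnt_nonneg _, fun i => ?_, ?_⟩
  · exact (cnt_le rem i).trans (by exact_mod_cast h3)
  · rw [h2, ← Wd_flatMap, cnt_append, cnt_Wd _ _ _ (fun x hx => hlt x (h1.subset hx))]

/-- Frequency vectors as elements of `V3`. -/
noncomputable def fr (w : Seq) (s : ℕ) : V3 := (s : ℝ)⁻¹ • cnt (pw w s)

lemma limit_mem {n : ℕ → ℕ} (hn : ∀ R, ∃ r, R ≤ r ∧ n r ≠ 0) (φ : ℕ → ℕ) (hφ : StrictMono φ)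
    (x : V3) (hx : Tendsto (fun j => fr (Sseq 3 n) (φ j)) atTop (𝓝 x)) : x ∈ PP n := by
  have hφt : Tendsto (fun j => ((φ j : ℕ) : ℝ)⁻¹) atTop (𝓝 0) :=
    tendsto_inv_atTop_zero.comp (tendsto_natCast_atTop_atTop.comp hφ.tendsto_atTop)
  refine ⟨?_, fun r => ?_⟩
  · have h1 : Tendsto (fun j => sm (fr (Sseq 3 n) (φ j))) atTop (𝓝 (sm x)) :=
      ((LinearMap.continuous_of_finiteDimensional sm).tendsto x).comp hx
    refine tendsto_nhds_unique h1 (tendsto_const_nhds.congr' ?_)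
    filter_upwards [hφ.tendsto_atTop.eventually (eventually_ge_atTop 1)] with j hj
    rw [fr, map_smul, sm_cnt _ (pw_lt hn _), pw_length, smul_eq_mul, inv_mul_cancel₀]
    have : (1:ℝ) ≤ (φ j : ℝ) := by exact_mod_cast hj
    positivity
  · obtain ⟨B, hB⟩ := pw_decomp hn r
    choose y rem hy hrem hremB heq using hB
    have hr0 : Tendsto (fun j => ((φ j : ℕ) : ℝ)⁻¹ • rem (φ j)) atTop (𝓝 0) := by
      rw [tendsto_pi_nhds]
      intro i
      have hb : Tendsto (fun j => ((φ j : ℕ) : ℝ)⁻¹ * B) atTop (𝓝 0) := by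
        simpa using hφt.mul_const (B : ℝ)
      refine squeeze_zero (fun j => ?_) (fun j => ?_) hb
      · have := hrem (φ j) i
        simp only [Pi.zero_apply] at this
        simp only [Pi.smul_apply, smul_eq_mul]
        positivity
      · simp only [Pi.smul_apply, smul_eq_mul]
        exact mul_le_mul_of_nonneg_left (hremB _ i) (by positivity)
    have hc := (LinearMap.continuous_of_finiteDimensional (TT n r))
    have h1 : Tendsto (fun j => TT n r (fr (Sseq 3 n) (φ j) - ((φ j : ℕ) : ℝ)⁻¹ • rem (φ j)))
        atTop (𝓝 (TT n r x)) := by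
      have := (hc.tendsto (x - 0)).comp (hx.sub hr0)
      rwa [sub_zero] at this
    refine ge_of_tendsto' h1 (fun j => ?_)
    have : fr (Sseq 3 n) (φ j) - ((φ j : ℕ) : ℝ)⁻¹ • rem (φ j) =
        ((φ j : ℕ) : ℝ)⁻¹ • AA n r (y (φ j)) := by
      rw [fr, heq, smul_add, add_sub_cancel_right]
    rw [this, map_smul, TT_AA]
    exact smul_nonneg (by positivity) (hy _)

lemma crossing (g : ℕ → ℝ) (hg : ∀ s, |g (s+1) - g s| ≤ 2) (ε : ℝ) (hε : 0 < ε)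
    (h1 : ∀ S, ∃ s, S ≤ s ∧ -(ε * s) < g s) (h2 : ∀ S, ∃ s, S ≤ s ∧ g s < ε * s) :
    ∀ S, ∃ s, S ≤ s ∧ |g s| ≤ ε * s := by
  intro S
  obtain ⟨N, hN⟩ := exists_nat_gt (2 / ε)
  rw [div_lt_iff₀ hε] at hN
  obtain ⟨s0, hs0, hg0⟩ := h1 (max S N)
  by_cases hc : g s0 ≤ ε * s0
  · exact ⟨s0, (le_max_left _ _).trans hs0, abs_le.2 ⟨hg0.le, hc⟩⟩
  push Not at hc
  have hex : ∃ t, g (s0 + t) < ε * ((s0 + t : ℕ) : ℝ) := by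
    obtain ⟨s, hs, hgs⟩ := h2 s0
    exact ⟨s - s0, by rw [show s0 + (s - s0) = s by omega]; exact hgs⟩
  have hsp := Nat.find_spec hex
  have hmin := fun t => Nat.find_min (m := t) hex
  set t := Nat.find hex
  rcases Nat.eq_zero_or_pos t with h0 | hpos
  · rw [h0] at hsp
    simp at hsp
    linarith
  · obtain ⟨t', ht'⟩ : ∃ t', t = t' + 1 := ⟨t - 1, by omega⟩
    have h3 := hmin t' (by omega)
    rw [ht'] at hsp
    push Not at h3
    have h4 := abs_le.1 (hg (s0 + t'))
    refine ⟨s0 + t' + 1, ?_, abs_le.2 ⟨?_, hsp.le⟩⟩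
    · have := (le_max_left S N).trans hs0; omega
    · have h5 : (N : ℝ) ≤ s0 := by exact_mod_cast (le_max_right S N).trans hs0
      push_cast at h3 ⊢
      have h6 : 0 ≤ (t' : ℝ) := by positivity
      have h7 : 0 ≤ (s0 : ℝ) := by positivity
      have h8 : 0 ≤ ε * ((s0 : ℝ) + t') := by positivity
      have h9 : ε * N ≤ ε * s0 := by gcongr
      nlinarith [mul_nonneg hε.le h6, h4.1]

lemma pw_succ (w : Seq) (s : ℕ) : pw w (s+1) = pw w s ++ [w s] := by
  simp [pw, List.range_succ]

lemma freq_close {n : ℕ → ℕ} (hn : ∀ R, ∃ r, R ≤ r ∧ n r ≠ 0) (x : V3) (hx : x ∈ PP n)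
    (i : Fin 3) (ε : ℝ) (hε : 0 < ε) (S : ℕ) :
    ∃ s, S ≤ s ∧ |cnt (pw (Sseq 3 n) s) i - x i * s| ≤ ε * s := by
  have hx0 : ∀ j, 0 ≤ x j := hx.2 0
  have hx1 : x i ≤ 1 := by
    have h := hx.1
    rw [sm_apply] at h
    have a0 := hx0 0
    have a1 := hx0 1
    have a2 := hx0 2
    fin_cases i <;> simp <;> linarith
  have hcnt : ∀ r, cnt (pw (Sseq 3 n) (Cw n r).length) = cv n r := by
    intro r
    rw [← Cw_eq_pw hn, cnt_Cw]
  have hlen : ∀ r, sm (cv n r) = (Cw n r).length := by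
    intro r
    rw [← cnt_Cw]
    exact sm_cnt _ (Wd_lt n r [2] (by simp))
  apply crossing _ _ ε hε
  · intro S
    obtain ⟨R, hR⟩ := Cw_unbounded n hn S
    let lam : V3 →ₗ[ℝ] ℝ := LinearMap.proj i - (x i - ε) • sm
    have hl : ∀ v, lam v = v i - (x i - ε) * sm v := by intro v; simp [lam]
    obtain ⟨r, hr, hpos⟩ := hull n x hx lam (by rw [hl, hx.1]; linarith) R
    refine ⟨(Cw n r).length, (hR r hr).le, ?_⟩
    rw [hl, hlen] at hpos
    rw [hcnt]
    linarith
  · intro S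
    obtain ⟨R, hR⟩ := Cw_unbounded n hn S
    let lam : V3 →ₗ[ℝ] ℝ := (x i + ε) • sm - LinearMap.proj i
    have hl : ∀ v, lam v = (x i + ε) * sm v - v i := by intro v; simp [lam]
    obtain ⟨r, hr, hpos⟩ := hull n x hx lam (by rw [hl, hx.1]; linarith) R
    refine ⟨(Cw n r).length, (hR r hr).le, ?_⟩
    rw [hl, hlen] at hpos
    rw [hcnt]
    linarith
  · intro s
    rw [pw_succ, cnt_append, Pi.add_apply]
    have b0 : 0 ≤ cnt [Sseq 3 n s] i := cnt_nonneg _ i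
    have b1 := cnt_le [Sseq 3 n s] i
    simp at b1
    have := hx0 i
    push_cast
    rw [abs_le]
    constructor <;> linarith

lemma mem_limit {n : ℕ → ℕ} (hn : ∀ R, ∃ r, R ≤ r ∧ n r ≠ 0) (x q : V3) (hx : x ∈ PP n)
    (hq : q ∈ PP n) (hne : q ≠ x) :
    ∃ φ : ℕ → ℕ, StrictMono φ ∧ (∀ j, 1 ≤ φ j) ∧
      Tendsto (fun j => fr (Sseq 3 n) (φ j)) atTop (𝓝 x) := by
  obtain ⟨i, hi⟩ : ∃ i, x i ≠ q i := by
    by_contra h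
    push Not at h
    exact hne (funext fun i => (h i).symm)
  obtain ⟨φ, hφ, hφp⟩ := extraction_forall_of_frequently (P := fun j s => 1 ≤ s ∧
      |cnt (pw (Sseq 3 n) s) i - x i * s| ≤ (1 / ((j : ℝ) + 1)) * s) (by
    intro j
    rw [frequently_atTop]
    intro S
    obtain ⟨s, hs, h⟩ := freq_close hn x hx i (1 / ((j : ℝ) + 1)) (by positivity) (max S 1)
    exact ⟨s, (le_max_left _ _).trans hs, (le_max_right _ _).trans hs, h⟩)
  have hfi : Tendsto (fun j => fr (Sseq 3 n) (φ j) i) atTop (𝓝 (x i)) := by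
    rw [tendsto_iff_dist_tendsto_zero]
    refine squeeze_zero (fun _ => dist_nonneg) (fun j => ?_)
      (tendsto_one_div_add_atTop_nhds_zero_nat (𝕜 := ℝ))
    obtain ⟨h1, h2⟩ := hφp j
    have hp : (0:ℝ) < φ j := by exact_mod_cast h1
    rw [Real.dist_eq, fr, Pi.smul_apply, smul_eq_mul]
    have : ((φ j : ℕ) : ℝ)⁻¹ * cnt (pw (Sseq 3 n) (φ j)) i - x i =
        (cnt (pw (Sseq 3 n) (φ j)) i - x i * φ j) / φ j := by
      field_simp
    rw [this, abs_div, abs_of_pos hp, div_le_iff₀ hp]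
    exact h2
  have hK : IsCompact (Set.univ.pi fun _ : Fin 3 => Set.Icc (0:ℝ) 1) :=
    isCompact_univ_pi fun _ => isCompact_Icc
  obtain ⟨y, -, ψ, hψ, hlim⟩ := hK.tendsto_subseq (x := fun j => fr (Sseq 3 n) (φ j)) (by
    intro j k _
    obtain ⟨h1, h2⟩ := hφp j
    have hp : (0:ℝ) < φ j := by exact_mod_cast h1
    have c0 : 0 ≤ cnt (pw (Sseq 3 n) (φ j)) k := cnt_nonneg _ k
    have c1 := cnt_le (pw (Sseq 3 n) (φ j)) k
    rw [pw_length] at c1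
    simp only [fr, Pi.smul_apply, smul_eq_mul]
    refine ⟨by positivity, ?_⟩
    rw [inv_mul_le_iff₀ hp]
    linarith)
  have hyP : y ∈ PP n := limit_mem hn (φ ∘ ψ) (hφ.comp hψ) y hlim
  have hyi : y i = x i :=
    tendsto_nhds_unique ((tendsto_pi_nhds.1 hlim) i) (hfi.comp hψ.tendsto_atTop)
  have : y = x := PP_inj n x q y hx hq hyP i hi hyi
  rw [this] at hlim
  exact ⟨φ ∘ ψ, hφ.comp hψ, fun j => (hφp (ψ j)).1, hlim⟩

lemma PP_ev_zero (n : ℕ → ℕ) (R : ℕ) (hR : ∀ r, R ≤ r → n r = 0) : ∃ x, PP n = {x} := by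
  have hc : ∀ r, R ≤ r → cv n r = cv n R := by
    intro r hr
    induction r, hr using Nat.le_induction with
    | base => rfl
    | succ r hr ih => rw [cv_succ, hR r hr, ih]; simp
  have hs : 0 < sm (cv n R) := by linarith [sm_c n R]
  refine ⟨(sm (cv n R))⁻¹ • cv n R, Set.eq_singleton_iff_unique_mem.2 ⟨⟨?_, fun r => ?_⟩, ?_⟩⟩
  · rw [map_smul, smul_eq_mul, inv_mul_cancel₀ hs.ne']
  · apply TT_nonneg_of_le n (le_max_left r R)
    rw [map_smul, ← hc _ (le_max_right r R), cv, TT_AA]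
    refine smul_nonneg ?_ e2_nonneg
    have := sm_c n (max r R)
    rw [cv] at this
    positivity
  · intro x hx
    ext i
    set t := ((sm (cv n R))⁻¹ • cv n R) i with ht
    have hti : cv n R i = t * sm (cv n R) := by
      rw [ht, Pi.smul_apply, smul_eq_mul]; field_simp
    apply le_antisymm
    · by_contra hlt
      push Not at hlt
      let lam : V3 →ₗ[ℝ] ℝ := LinearMap.proj i - t • sm
      have hl : ∀ v, lam v = v i - t * sm v := by intro v; simp [lam]
      obtain ⟨r, hr, hpos⟩ := hull n x hx lam (by rw [hl, hx.1]; linarith) R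
      rw [hc r hr, hl, hti] at hpos
      linarith
    · by_contra hlt
      push Not at hlt
      let lam : V3 →ₗ[ℝ] ℝ := t • sm - LinearMap.proj i
      have hl : ∀ v, lam v = t * sm v - v i := by intro v; simp [lam]
      obtain ⟨r, hr, hpos⟩ := hull n x hx lam (by rw [hl, hx.1]; linarith) R
      rw [hc r hr, hl, hti] at hpos
      linarith

/-! ### The fiber -/

lemma ofLp_freqVec (w : Seq) (s : ℕ) : WithLp.ofLp (freqVec 3 w s) = fr w s := by
  ext i
  simp only [freqVec, fr, cnt, pw, Pi.smul_apply, smul_eq_mul, ← digitCount_eq]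
  simp [div_eq_inv_mul]

lemma proj0 (α : E 3) : proj α 0 = α.ofLp 0 := by simp [proj]
lemma proj1 (α : E 3) : proj α 1 = α.ofLp 1 := by simp [proj]
lemma proj2 (α : E 3) : proj α 2 = α.ofLp 2 := by simp [proj]

lemma Kmap_ofLp (m : ℕ) (α : E 3) :
    (Kmap m α).ofLp = (1 - α.ofLp 0)⁻¹ • Tmat m α.ofLp := by
  ext i
  rw [Tmat_apply]
  fin_cases i <;> simp [Kmap, proj0, proj1, proj2, div_eq_inv_mul]

lemma mem_simplex' (α : E 3) :
    α ∈ simplex' 3 ↔ 0 ≤ α.ofLp 0 ∧ 0 ≤ α.ofLp 1 ∧ 0 < α.ofLp 2 ∧ sm α.ofLp = 1 := by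
  simp only [simplex', faceF, simplex, Set.mem_diff, Set.mem_setOf_eq, Fin.forall_fin_succ,
    Fin.sum_univ_three, sm_apply, proj2, show 3 - 1 = 2 from rfl]
  simp
  constructor
  · rintro ⟨⟨⟨h0, h1, h2⟩, h3⟩, h4⟩
    exact ⟨h0, h1, lt_of_le_of_ne h2 (Ne.symm (h4 h0 h1 h2 h3)), h3⟩
  · rintro ⟨h0, h1, h2, h3⟩
    exact ⟨⟨⟨h0, h1, h2.le⟩, h3⟩, fun _ _ _ _ => h2.ne'⟩

lemma Jfun_eq (α : E 3) : Jfun α = ⌊α.ofLp 0 / α.ofLp 2⌋₊ := by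
  rw [Jfun, proj0, show 3 - 1 = 2 from rfl, proj2]

lemma Kstep_good (α : E 3) (h : α ∈ simplex' 3) : Kstep α ∈ simplex' 3 ∧
    ∃ κ : ℝ, 0 < κ ∧ Tmat (Jfun α) α.ofLp = κ • (Kstep α).ofLp := by
  rw [mem_simplex'] at h
  obtain ⟨h0, h1, h2, h3⟩ := h
  have hJ := Jfun_eq α
  set m := Jfun α with hm
  have hq : 0 ≤ α.ofLp 0 / α.ofLp 2 := by positivity
  have f1 := Nat.floor_le hq
  have f2 := Nat.lt_floor_add_one (α.ofLp 0 / α.ofLp 2)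
  rw [← hJ] at f1 f2
  rw [le_div_iff₀ h2] at f1
  rw [div_lt_iff₀ h2] at f2
  rw [sm_apply] at h3
  have hk : 0 < 1 - α.ofLp 0 := by linarith
  have hK : (Kstep α).ofLp = (1 - α.ofLp 0)⁻¹ • Tmat m α.ofLp := by
    rw [Kstep, Kmap_ofLp]
  refine ⟨?_, 1 - α.ofLp 0, hk, ?_⟩
  · rw [mem_simplex', hK, Tmat_apply, sm_apply]
    simp
    refine ⟨by positivity, ?_, ?_, ?_⟩
    · exact mul_nonneg (by positivity) (by linarith)
    · exact mul_pos (by positivity) (by linarith)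
    · field_simp
      linarith
  · rw [hK, smul_smul, mul_inv_cancel₀ hk.ne', one_smul]

lemma fiber_fwd (n : ℕ → ℕ) (α : E 3) (h : α ∈ simplex' 3) (hP : Phi α = n) (r : ℕ) :
    Kstep^[r] α ∈ simplex' 3 ∧ ∃ κ : ℝ, 0 < κ ∧ TT n r α.ofLp = κ • (Kstep^[r] α).ofLp := by
  induction r with
  | zero => exact ⟨h, 1, one_pos, by simp [TT]⟩
  | succ r ih =>
    obtain ⟨hs, κ, hκ, he⟩ := ih
    obtain ⟨hs', κ', hκ', he'⟩ := Kstep_good _ hs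
    have hJ : Jfun (Kstep^[r] α) = n r := congrFun hP r
    rw [Function.iterate_succ_apply']
    refine ⟨hs', κ * κ', by positivity, ?_⟩
    rw [TT_succ, he, map_smul, ← hJ, he', smul_smul]

lemma third_pos (n : ℕ → ℕ) (x : V3) (hx : ∀ r, 0 ≤ TT n r x) (r : ℕ) (hs : 0 < sm (TT n r x)) :
    0 < TT n r x 2 := by
  have p0 := hx r 0
  have p1 := hx r 1
  have p2 := hx r 2
  have q2 := hx (r+1) 2
  have s2 := hx (r+2) 2
  rw [TT_succ, Tmat_apply] at q2
  rw [TT_succ, TT_succ, Tmat_apply, Tmat_apply] at s2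
  rw [sm_apply] at hs
  simp at p0 p1 p2 q2 s2
  by_contra hc
  have z2 : TT n r x 2 = 0 := by linarith
  rw [z2] at q2 s2 hs
  have z0 : TT n r x 0 = 0 := by linarith
  rw [z0] at s2 hs
  simp at s2
  linarith

lemma sm_TT_pos (n : ℕ → ℕ) (x : V3) (hx : x ∈ PP n) (r : ℕ) : 0 < sm (TT n r x) := by
  induction r with
  | zero => simp [TT, hx.1]
  | succ r ih =>
    have h2 := third_pos n x hx.2 r ih
    have h1 := hx.2 r 1
    simp only [Pi.zero_apply] at h1
    rw [TT_succ, Tmat_apply, sm_apply]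
    simp
    linarith

lemma fiber_bwd (n : ℕ → ℕ) (α : E 3) (h : α.ofLp ∈ PP n) (r : ℕ) :
    Kstep^[r] α ∈ simplex' 3 ∧ Jfun (Kstep^[r] α) = n r ∧
      ∃ κ : ℝ, 0 < κ ∧ TT n r α.ofLp = κ • (Kstep^[r] α).ofLp := by
  have hfloor : ∀ r, ∀ γ : E 3, ∀ κ : ℝ, 0 < κ → TT n r α.ofLp = κ • γ.ofLp →
      Jfun γ = n r := by
    intro r γ κ hκ he
    have t2 := third_pos n _ h.2 r (sm_TT_pos n _ h r)
    have u2 := third_pos n _ h.2 (r+1) (sm_TT_pos n _ h (r+1))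
    have u1 := h.2 (r+1) 1
    rw [TT_succ, he, Tmat_apply] at u1 u2
    rw [he] at t2
    simp at t2 u1 u2
    have g2 : 0 < γ.ofLp 2 := (mul_pos_iff_of_pos_left hκ).1 t2
    have v1 : n r * γ.ofLp 2 ≤ γ.ofLp 0 := by
      by_contra hcc
      push Not at hcc
      nlinarith
    have v2 : γ.ofLp 0 < (n r + 1) * γ.ofLp 2 := by
      by_contra hcc
      push Not at hcc
      nlinarith
    rw [Jfun_eq, Nat.floor_eq_iff (by
      have : 0 ≤ (n r : ℝ) * γ.ofLp 2 := by positivity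
      have : 0 ≤ γ.ofLp 0 := by linarith
      positivity), le_div_iff₀ g2, div_lt_iff₀ g2]
    exact ⟨v1, v2⟩
  induction r with
  | zero =>
    have he : TT n 0 α.ofLp = (1:ℝ) • α.ofLp := by simp [TT]
    refine ⟨?_, hfloor 0 α 1 one_pos he, 1, one_pos, he⟩
    rw [Function.iterate_zero, id, mem_simplex']
    exact ⟨h.2 0 0, h.2 0 1, third_pos n _ h.2 0 (sm_TT_pos n _ h 0), h.1⟩
  | succ r ih =>
    obtain ⟨hs, hJ, κ, hκ, he⟩ := ih
    obtain ⟨hs', κ', hκ', he'⟩ := Kstep_good _ hs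
    rw [Function.iterate_succ_apply']
    have he2 : TT n (r+1) α.ofLp = (κ * κ') • (Kstep (Kstep^[r] α)).ofLp := by
      rw [TT_succ, he, map_smul, ← hJ, he', smul_smul]
    exact ⟨hs', hfloor _ _ _ (by positivity) he2, κ * κ', by positivity, he2⟩

lemma mem_fiber_iff (n : ℕ → ℕ) (α : E 3) : α ∈ PhiFiber 3 n ↔ α.ofLp ∈ PP n := by
  constructor
  · rintro ⟨h1, h2⟩
    refine ⟨((mem_simplex' α).1 h1).2.2.2, fun r => ?_⟩
    obtain ⟨hs, κ, hκ, he⟩ := fiber_fwd n α h1 h2 r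
    rw [he]
    obtain ⟨a, b, c, -⟩ := (mem_simplex' _).1 hs
    refine smul_nonneg hκ.le ?_
    intro i
    fin_cases i
    · exact a
    · exact b
    · exact c.le
  · intro h
    exact ⟨(fiber_bwd n α h 0).1, funext fun r => (fiber_bwd n α h r).2.1⟩

/-- `k = 3`: if `β ∈ (2,3)` is such that `n = max{m ∈ N : S(m) ≤ d_β(1)}`
lies in `ℕ^ℕ` and is exceptional, then the set `F_β` of subsequential digit frequencies of
`d_β(1)` equals `Φ^{-1}(n)`. -/
theorem stmt19 (β : ℝ) (h1 : 2 < β) (h2 : β < 3) (n : ℕ → ℕ)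
    (hle : seqLe (SN 3 (toNN n)) (dbeta β 1))
    (hmax : ∀ m : NN, seqLe (SN 3 m) (dbeta β 1) → nnLe m (toNN n))
    (hexc : ¬ ∃ α : E 3, PhiFiber 3 n = {α}) :
    {α : E 3 | ∃ φ : ℕ → ℕ, StrictMono φ ∧ (∀ j, 1 ≤ φ j) ∧
        Tendsto (fun j => freqVec 3 (dbeta β 1) (φ j)) atTop (𝓝 α)} = PhiFiber 3 n := by
  have hiff := mem_fiber_iff n
  have hn : ∀ R, ∃ r, R ≤ r ∧ n r ≠ 0 := by
    by_contra hcon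
    push Not at hcon
    obtain ⟨R, hR⟩ := hcon
    obtain ⟨x, hx⟩ := PP_ev_zero n R hR
    apply hexc
    refine ⟨WithLp.toLp 2 x, ?_⟩
    ext α
    rw [hiff, hx, Set.mem_singleton_iff, Set.mem_singleton_iff]
    constructor
    · intro h
      rw [← h]
    · intro h
      rw [h]
  have hS : Sseq 3 n = dbeta β 1 := seqLe_eq n hn _ hle hmax
  rw [← hS]
  ext α
  rw [Set.mem_setOf_eq]
  constructor
  · rintro ⟨φ, hφ, _, hlim⟩
    rw [hiff]
    apply limit_mem hn φ hφ
    have := ((PiLp.continuous_ofLp 2 (fun _ : Fin 3 => ℝ)).tendsto α).comp hlim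
    refine this.congr (fun j => ?_)
    exact ofLp_freqVec _ _
  · intro hα
    have hx := (hiff α).1 hα
    obtain ⟨γ, hγ, hne⟩ : ∃ γ ∈ PhiFiber 3 n, γ ≠ α := by
      by_contra hcon
      push Not at hcon
      exact hexc ⟨α, Set.eq_singleton_iff_unique_mem.2 ⟨hα, hcon⟩⟩
    obtain ⟨φ, h1, h2, h3⟩ := mem_limit hn _ _ hx ((hiff γ).1 hγ)
      (fun h => hne (WithLp.ofLp_injective 2 h))
    refine ⟨φ, h1, h2, ?_⟩
    have := ((PiLp.continuous_toLp 2 (fun _ : Fin 3 => ℝ)).tendsto _).comp h3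
    refine this.congr (fun j => ?_)
    apply WithLp.ofLp_injective 2
    exact (ofLp_freqVec _ _).symm

end BetaDF
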